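/- Let p be a prime with p > 2^{20} and let σ be a positive integer with 0 < |σ − p − 1| ≤ 2√p. Let E : y² = x³ + Ax + B be an elliptic curve over F_p with #E(F_p) ≠ σ, let α ∈ F_p be a quadratic non-residue, let E^t : y² = x³ + α⁻²Ax + α⁻³B be the quadratic twist of E, and suppose (2p + 2 − σ)·Q = 0 for every Q ∈ E^t(F_p). Then the set S = {P ∈ E(F_p) : σ·P = 0} is a proper subgroup of E(F_p), and #S ≤ #E(F_p)/2 ≤ (p + 1 + 2√p)/2. -/

import Mathlib

/-- The short Weierstrass curve `y² = x³ + Ax + B` over a field `F`. -/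
def shortWeierstrass (F : Type) [Field F] (A B : F) : WeierstrassCurve.Affine F :=
  { a₁ := 0, a₂ := 0, a₃ := 0, a₄ := A, a₆ := B }

open WeierstrassCurve WeierstrassCurve.Affine

set_option linter.unusedSectionVars false

section gen
variable {k : Type} [Field k] {a b : k}

lemma sw_Δ : (shortWeierstrass k a b).Δ = -16 * (4 * a ^ 3 + 27 * b ^ 2) := by
  simp only [WeierstrassCurve.Δ, WeierstrassCurve.b₂, WeierstrassCurve.b₄, WeierstrassCurve.b₆,
    WeierstrassCurve.b₈, shortWeierstrass]
  ring

lemma sw_eq_iff {x y : k} : (shortWeierstrass k a b).Equation x y ↔ y ^ 2 = x ^ 3 + a * x + b := by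
  rw [equation_iff]
  simp [shortWeierstrass]

lemma sw_ns_iff (hΔ : (shortWeierstrass k a b).Δ ≠ 0) {x y : k} :
    (shortWeierstrass k a b).Nonsingular x y ↔ y ^ 2 = x ^ 3 + a * x + b := by
  rw [← equation_iff_nonsingular_of_Δ_ne_zero hΔ, sw_eq_iff]

lemma sw_negY {x y : k} : (shortWeierstrass k a b).negY x y = - y := by
  simp [negY, shortWeierstrass]

lemma sw_addX {x y l : k} : (shortWeierstrass k a b).addX x y l = l ^ 2 - x - y := by
  simp [addX, shortWeierstrass]

/-- `(u : v)` is the x-coordinate of `P`. -/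
def XCoord (P : (shortWeierstrass k a b).Point) (u v : k) : Prop :=
  ∃ c : k, c ≠ 0 ∧ u = c * P.xRep 0 ∧ v = c * P.xRep 1

lemma exists_rep (P : (shortWeierstrass k a b).Point) : ∃ u v, XCoord P u v :=
  ⟨P.xRep 0, P.xRep 1, 1, one_ne_zero, by simp, by simp⟩

lemma XCoord_zero_iff {u v : k} : XCoord (0 : (shortWeierstrass k a b).Point) u v ↔ v = 0 ∧ u ≠ 0 := by
  constructor
  · rintro ⟨c, hc, rfl, rfl⟩
    simp [hc]
  · rintro ⟨rfl, hu⟩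
    exact ⟨u, hu, by simp, by simp⟩

lemma XCoord_some_iff {u v x y : k} {h} :
    XCoord (.some x y h : (shortWeierstrass k a b).Point) u v ↔ v ≠ 0 ∧ u = x * v := by
  constructor
  · rintro ⟨c, hc, rfl, rfl⟩
    simp [hc, mul_comm]
  · rintro ⟨hv, hu⟩
    exact ⟨v, hv, by simp [hu, mul_comm], by simp⟩

/-- The polynomials of the addition-subtraction map. -/
def F0 {k : Type} [CommRing k] (u₁ v₁ u₂ v₂ : k) : k := (u₁ * v₂ - u₂ * v₁) ^ 2
def F1 {k : Type} [CommRing k] (a b u₁ v₁ u₂ v₂ : k) : k :=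
  2 * ((u₁ * v₂ + u₂ * v₁) * (u₁ * u₂ + a * v₁ * v₂) + 2 * b * v₁ ^ 2 * v₂ ^ 2)
def F2 {k : Type} [CommRing k] (a b u₁ v₁ u₂ v₂ : k) : k :=
  (u₁ * u₂ - a * v₁ * v₂) ^ 2 - 4 * b * (u₁ * v₂ + u₂ * v₁) * v₁ * v₂

variable [DecidableEq k]

/-- The triple attached to `R, S` is proportional to the addition-subtraction map of `P, Q`. -/
def Good (P Q R S : (shortWeierstrass k a b).Point) : Prop :=
  ∃ c : k, c ≠ 0 ∧ R.xRep 1 * S.xRep 1 = c * F0 (P.xRep 0) (P.xRep 1) (Q.xRep 0) (Q.xRep 1) ∧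
  R.xRep 0 * S.xRep 1 + S.xRep 0 * R.xRep 1 =
    c * F1 a b (P.xRep 0) (P.xRep 1) (Q.xRep 0) (Q.xRep 1) ∧
  R.xRep 0 * S.xRep 0 = c * F2 a b (P.xRep 0) (P.xRep 1) (Q.xRep 0) (Q.xRep 1)

lemma good_dbl (hΔ : (shortWeierstrass k a b).Δ ≠ 0) (P : (shortWeierstrass k a b).Point) :
    Good P P (P + P) 0 := by
  have h2 : (2 : k) ≠ 0 := by
    intro h
    apply hΔ
    rw [sw_Δ]
    linear_combination (-8 * (4 * a ^ 3 + 27 * b ^ 2)) * h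
  rcases P with _ | ⟨x, y, h⟩
  · rw [← Point.zero_def]
    exact ⟨1, one_ne_zero, by simp [F0], by simp [F1], by simp [F2]⟩
  · have e := (sw_ns_iff hΔ).1 h
    by_cases hy : y = 0
    · rw [Point.add_self_of_Y_eq (by rw [sw_negY, hy, neg_zero])]
      have hne : (x * x - a) ^ 2 - 4 * b * (x + x) ≠ 0 := by
        intro h0
        apply hΔ
        rw [sw_Δ]
        subst hy
        linear_combination (-16) * ((3 * x ^ 2 + 4 * a) * h0 + (3*x^3 - 5 *a *x - 27*b) * e)
      refine ⟨((x * x - a) ^ 2 - 4 * b * (x + x))⁻¹, inv_ne_zero hne, by simp [F0], ?_, ?_⟩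
      · simp only [Point.xRep_zero, Point.xRep_some, F1]
        simp
        right; right
        subst hy
        linear_combination (-2) * e
      · simp only [Point.xRep_zero, Point.xRep_some, F2]
        simp
        rw [inv_mul_cancel₀ hne]
    · have hy' : y ≠ (shortWeierstrass k a b).negY x y := by
        rw [sw_negY]
        intro h
        have : 2 * y = 0 := by linear_combination h
        simp [h2, hy] at this
      rw [Point.add_self_of_Y_ne hy']
      have hs : (shortWeierstrass k a b).slope x x y y = (3 * x ^ 2 + a) / (2 * y) := by
        rw [slope_of_Y_ne rfl hy', sw_negY]
        simp only [shortWeierstrass]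
        congr 1 <;> ring
      refine ⟨(4 * y ^ 2)⁻¹, inv_ne_zero ?_, by simp [F0], ?_, ?_⟩
      · have : (4 : k) = 2 * 2 := by norm_num
        simp [this, h2, hy]
      · simp only [Point.xRep_zero, Point.xRep_some, F1]
        have h4 : (4 : k) ≠ 0 := by
          have : (4 : k) = 2 * 2 := by norm_num
          simp [this, h2]
        simp
        field_simp
        linear_combination 4 * e
      · simp only [Point.xRep_zero, Point.xRep_some, F2, sw_addX, hs]
        have h4 : (4 : k) ≠ 0 := by
          have : (4 : k) = 2 * 2 := by norm_num
          simp [this, h2]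
        simp
        field_simp
        linear_combination (-32 * x) * e

lemma good_symm {P Q R S : (shortWeierstrass k a b).Point} (h : Good P Q R S) : Good P Q S R := by
  obtain ⟨c, hc, h0, h1, h2⟩ := h
  exact ⟨c, hc, by rw [mul_comm, h0], by rw [add_comm, h1], by rw [mul_comm, h2]⟩

lemma good_neg {P Q R S : (shortWeierstrass k a b).Point} (h : Good P Q R S) : Good P (-Q) R S := by
  simpa [Good] using h

lemma good_add_sub (hΔ : (shortWeierstrass k a b).Δ ≠ 0) (P Q : (shortWeierstrass k a b).Point) :
    Good P Q (P + Q) (P - Q) := by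
  by_cases hPQ : P = Q
  · subst hPQ
    simpa using good_dbl hΔ P
  by_cases hPQ' : P = -Q
  · have : Q = -P := by rw [hPQ', neg_neg]
    subst this
    simpa using good_symm (good_neg (good_dbl hΔ P))
  rcases P with _ | ⟨x₁, y₁, h₁⟩
  · rw [← Point.zero_def]
    refine ⟨1, one_ne_zero, ?_, ?_, ?_⟩ <;> simp [F0, F1, F2] <;> ring
  rcases Q with _ | ⟨x₂, y₂, h₂⟩
  · rw [← Point.zero_def]
    refine ⟨1, one_ne_zero, ?_, ?_, ?_⟩ <;> simp [F0, F1, F2] <;> ring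
  have hx : x₁ ≠ x₂ := by
    intro hx
    rcases Point.X_eq_iff.1 hx with h | h
    · exact hPQ h
    · exact hPQ' h
  have e1 := (sw_ns_iff hΔ).1 h₁
  have e2 := (sw_ns_iff hΔ).1 h₂
  rw [sub_eq_add_neg, Point.neg_some, Point.add_of_X_ne hx, Point.add_of_X_ne hx]
  have hd : x₁ - x₂ ≠ 0 := sub_ne_zero.2 hx
  simp only [Good, Point.xRep_some, sw_addX, slope_of_X_ne hx, sw_negY, F0, F1, F2]
  refine ⟨((x₁ - x₂) ^ 2)⁻¹, inv_ne_zero (pow_ne_zero _ hd), ?_, ?_, ?_⟩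
  · simp [hd]
  · simp
    field_simp
    linear_combination (2 * e1 + 2 * e2)
  · simp
    have e1' : b = y₁ ^ 2 - x₁ ^ 3 - a * x₁ := by linear_combination -e1
    have e2' : a * (x₁ - x₂) = y₁ ^ 2 - y₂ ^ 2 - x₁ ^ 3 + x₂ ^ 3 := by linear_combination e2 - e1
    have e3 : a = (y₁ ^ 2 - y₂ ^ 2 - x₁ ^ 3 + x₂ ^ 3) / (x₁ - x₂) := by field_simp; exact e2'
    rw [e1', e3]
    field_simp
    ring

lemma rep_add_sub (hΔ : (shortWeierstrass k a b).Δ ≠ 0) {P Q : (shortWeierstrass k a b).Point}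
    {u₁ v₁ u₂ v₂ u₃ v₃ u₄ v₄ : k} (hP : XCoord P u₁ v₁) (hQ : XCoord Q u₂ v₂)
    (hR : XCoord (P + Q) u₃ v₃) (hS : XCoord (P - Q) u₄ v₄) :
    ∃ c : k, c ≠ 0 ∧ v₃ * v₄ = c * F0 u₁ v₁ u₂ v₂ ∧
      u₃ * v₄ + u₄ * v₃ = c * F1 a b u₁ v₁ u₂ v₂ ∧ u₃ * u₄ = c * F2 a b u₁ v₁ u₂ v₂ := by
  obtain ⟨c, hc, h0, h1, h2⟩ := good_add_sub hΔ P Q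
  obtain ⟨c1, hc1, rfl, rfl⟩ := hP
  obtain ⟨c2, hc2, rfl, rfl⟩ := hQ
  obtain ⟨c3, hc3, rfl, rfl⟩ := hR
  obtain ⟨c4, hc4, rfl, rfl⟩ := hS
  generalize (P + Q).xRep 0 = s0 at *
  generalize (P + Q).xRep 1 = s1 at *
  generalize (P - Q).xRep 0 = t0 at *
  generalize (P - Q).xRep 1 = t1 at *
  generalize P.xRep 0 = p0 at *
  generalize P.xRep 1 = p1 at *
  generalize Q.xRep 0 = q0 at *
  generalize Q.xRep 1 = q1 at *
  refine ⟨c * c3 * c4 / (c1 * c2) ^ 2, by positivity, ?_, ?_, ?_⟩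
  · simp only [F0] at *
    field_simp
    linear_combination h0
  · simp only [F1] at *
    field_simp
    linear_combination h1
  · simp only [F2] at *
    field_simp
    linear_combination h2

end gen

section ff
open Polynomial
variable {F : Type} [Field F]

/-- The cubic `X³ + AX + B`. -/
noncomputable def lam (A B : F) : F[X] := X ^ 3 + C A * X + C B

/-- The twist of the curve by `lam` over `F(X)`. -/
noncomputable abbrev WK (A B : F) : WeierstrassCurve.Affine (RatFunc F) :=
  shortWeierstrass (RatFunc F) (algebraMap F[X] (RatFunc F) (lam A B ^ 2 * C A))
    (algebraMap F[X] (RatFunc F) (lam A B ^ 3 * C B))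

lemma lam_natDegree (A B : F) : (lam A B).natDegree = 3 := by
  unfold lam; compute_degree!

lemma lam_ne_zero (A B : F) : lam A B ≠ 0 := by
  intro h
  have := lam_natDegree A B
  simp [h] at this

lemma WK_Δ {A B : F} (hΔ : (shortWeierstrass F A B).Δ ≠ 0) : (WK A B).Δ ≠ 0 := by
  rw [sw_Δ] at hΔ
  have : (WK A B).Δ = algebraMap F[X] (RatFunc F) (lam A B ^ 6 * C (-16 * (4 * A ^ 3 + 27 * B ^ 2))) := by
    rw [sw_Δ]
    simp only [map_mul, map_pow, map_add, map_neg, map_ofNat]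
    ring
  rw [this]
  refine (map_ne_zero_iff _ (RatFunc.algebraMap_injective F)).2 ?_
  refine mul_ne_zero (pow_ne_zero _ (lam_ne_zero A B)) ?_
  rwa [Ne, C_eq_zero]

/-- No common prime divisor. -/
def Prim3 (s0 s1 s2 : F[X]) : Prop := ∀ q : F[X], Prime q → q ∣ s0 → q ∣ s1 → q ∣ s2 → False

lemma Prim3.isUnit {s0 s1 s2 n : F[X]} (h : Prim3 s0 s1 s2) (hn : n ≠ 0) (h0 : n ∣ s0) (h1 : n ∣ s1)
    (h2 : n ∣ s2) : IsUnit n := by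
  by_contra hu
  obtain ⟨q, hq, hqn⟩ := WfDvdMonoid.exists_irreducible_factor hu hn
  exact h q hq.prime (hqn.trans h0) (hqn.trans h1) (hqn.trans h2)

lemma prim3_scale {s0 s1 s2 t0 t1 t2 : F[X]} (hs : Prim3 s0 s1 s2) (ht : Prim3 t0 t1 t2)
    {c : RatFunc F} (hc : c ≠ 0)
    (h0 : algebraMap F[X] (RatFunc F) s0 = c * algebraMap F[X] (RatFunc F) t0)
    (h1 : algebraMap F[X] (RatFunc F) s1 = c * algebraMap F[X] (RatFunc F) t1)
    (h2 : algebraMap F[X] (RatFunc F) s2 = c * algebraMap F[X] (RatFunc F) t2) :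
    ∃ d : F, d ≠ 0 ∧ s0 = C d * t0 ∧ s1 = C d * t1 ∧ s2 = C d * t2 := by
  have hcop := RatFunc.isCoprime_num_denom c
  have hd : c.denom ≠ 0 := RatFunc.denom_ne_zero c
  have hm : c.num ≠ 0 := RatFunc.num_ne_zero hc
  have hd' : algebraMap F[X] (RatFunc F) c.denom ≠ 0 :=
    (map_ne_zero_iff _ (RatFunc.algebraMap_injective F)).2 hd
  have key : ∀ s t : F[X], algebraMap F[X] (RatFunc F) s = c * algebraMap F[X] (RatFunc F) t →
      c.denom * s = c.num * t := by
    intro s t h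
    apply RatFunc.algebraMap_injective F
    rw [map_mul, map_mul, h]
    conv_lhs => rw [← RatFunc.num_div_denom c]
    rw [RatFunc.num_div_denom c, ← mul_assoc]
    congr 1
    conv_lhs => rw [mul_comm, ← RatFunc.num_div_denom c]
    rw [RatFunc.num_div_denom c]
    nth_rewrite 1 [← RatFunc.num_div_denom c]
    field_simp
  have hdu : IsUnit c.denom := ht.isUnit hd
    (hcop.symm.dvd_of_dvd_mul_left (Dvd.intro _ (key _ _ h0)))
    (hcop.symm.dvd_of_dvd_mul_left (Dvd.intro _ (key _ _ h1)))
    (hcop.symm.dvd_of_dvd_mul_left (Dvd.intro _ (key _ _ h2)))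
  have hnu : IsUnit c.num := hs.isUnit hm
    (hcop.dvd_of_dvd_mul_left (Dvd.intro _ (key _ _ h0).symm))
    (hcop.dvd_of_dvd_mul_left (Dvd.intro _ (key _ _ h1).symm))
    (hcop.dvd_of_dvd_mul_left (Dvd.intro _ (key _ _ h2).symm))
  obtain ⟨e, he, hE⟩ := Polynomial.isUnit_iff.1 hdu
  obtain ⟨m, hm', hM⟩ := Polynomial.isUnit_iff.1 hnu
  have he0 := he.ne_zero
  have fin : ∀ s t : F[X], c.denom * s = c.num * t → s = C (e⁻¹ * m) * t := by
    intro s t h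
    rw [← hE, ← hM] at h
    rw [C_mul, mul_assoc, ← h, ← mul_assoc, ← C_mul, inv_mul_cancel₀ he0]
    simp
  exact ⟨e⁻¹ * m, mul_ne_zero (inv_ne_zero he0) hm'.ne_zero, fin _ _ (key _ _ h0),
    fin _ _ (key _ _ h1), fin _ _ (key _ _ h2)⟩

lemma prim3_left {f g f' g' : F[X]} (h : IsCoprime f g) (h' : IsCoprime f' g') :
    Prim3 (g * g') (f * g' + f' * g) (f * f') := by
  have aux : ∀ {f g f' g' q: F[X]}, IsCoprime f g → IsCoprime f' g' → Prime q →
      q ∣ f * g' + f' * g → q ∣ f * f' → q ∣ g → False := by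
    intro f g f' g' q h h' hq h1 h2 hg
    have hf : ¬ q ∣ f := fun hf => hq.not_isUnit (h.isUnit_of_dvd' hf hg)
    have hf' : q ∣ f' := (hq.dvd_or_dvd h2).resolve_left hf
    have : q ∣ f * g' := (dvd_add_left (hg.mul_left _)).1 h1
    exact hq.not_isUnit (h'.isUnit_of_dvd' hf' ((hq.dvd_or_dvd this).resolve_left hf))
  intro q hq h0 h1 h2
  rcases hq.dvd_or_dvd h0 with hg | hg
  · exact aux h h' hq h1 h2 hg
  · exact aux h' h hq (by rwa [add_comm]) (by rwa [mul_comm]) hg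

lemma isUnit_of_dvd_disc {A B : F} (hΔ : (shortWeierstrass F A B).Δ ≠ 0) {q : F[X]}
    (h1 : q ∣ lam A B) (h2 : q ∣ (X ^ 2 - C A) ^ 2 - 8 * C B * X) : IsUnit q := by
  have : q ∣ C (4 * A ^ 3 + 27 * B ^ 2) := by
    have e : C (4 * A ^ 3 + 27 * B ^ 2) = (3 * X ^ 2 + 4 * C A) * ((X ^ 2 - C A) ^ 2 - 8 * C B * X)
        - (3 * X ^ 3 - 5 * C A * X - 27 * C B) * lam A B := by
      simp only [lam, map_add, map_mul, map_pow, map_ofNat]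
      ring
    rw [e]
    exact dvd_sub (h2.mul_left _) (h1.mul_left _)
  refine isUnit_of_dvd_unit this (isUnit_C.2 (IsUnit.mk0 _ ?_))
  rw [sw_Δ] at hΔ
  exact right_ne_zero_of_mul hΔ

lemma two_ne {A B : F} (hΔ : (shortWeierstrass F A B).Δ ≠ 0) : (2 : F) ≠ 0 := by
  intro h
  apply hΔ
  rw [sw_Δ]
  linear_combination (-8 * (4 * A ^ 3 + 27 * B ^ 2)) * h

lemma prim3_right {A B : F} (hΔ : (shortWeierstrass F A B).Δ ≠ 0) {f g : F[X]} (h : IsCoprime f g) :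
    Prim3 (F0 f g X 1) (F1 (C A) (C B) f g X 1) (F2 (C A) (C B) f g X 1) := by
  intro q hq h0 h1 h2
  have hfg : q ∣ f - X * g := by
    have := hq.dvd_of_dvd_pow h0
    simpa using this
  have hng : ¬ q ∣ g := fun hg => hq.not_isUnit (h.isUnit_of_dvd'
    (by have := dvd_add hfg (hg.mul_left X); simpa using this) hg)
  obtain ⟨r, hr⟩ := hfg
  have hf : f = X * g + q * r := by linear_combination hr
  have h1' : q ∣ 4 * (g ^ 2 * lam A B) := by
    have e : 4 * (g ^ 2 * lam A B) = F1 (C A) (C B) f g X 1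
      - q * (2 * r * (X * (f + X * g) + X * X * g + C A * g)) := by
      simp only [F1, lam, hf]; ring
    rw [e]
    exact dvd_sub h1 (Dvd.intro _ rfl)
  have h2' : q ∣ g ^ 2 * ((X ^ 2 - C A) ^ 2 - 8 * C B * X) := by
    have e : g ^ 2 * ((X ^ 2 - C A) ^ 2 - 8 * C B * X) = F2 (C A) (C B) f g X 1
      - q * (r * (X * (2 * (X * X * g - C A * g) + X * q * r) - 4 * C B * g)) := by
      simp only [F2, hf]; ring
    rw [e]
    exact dvd_sub h2 (Dvd.intro _ rfl)
  have hg2 : ¬ q ∣ g ^ 2 := fun h => hng (hq.dvd_of_dvd_pow h)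
  have h4 : ¬ q ∣ (4 : F[X]) := by
    intro h
    have h4 : (4 : F[X]) = C (2 * 2) := by simp only [map_mul, map_ofNat]; norm_num
    rw [h4] at h
    have := two_ne hΔ
    exact hq.not_isUnit (isUnit_of_dvd_unit h (isUnit_C.2 (IsUnit.mk0 _ (mul_ne_zero this this))))
  exact hq.not_isUnit (isUnit_of_dvd_disc hΔ
    ((hq.dvd_or_dvd ((hq.dvd_or_dvd h1').resolve_left h4)).resolve_left hg2)
    ((hq.dvd_or_dvd h2').resolve_left hg2))

/-- `f / g` is the reduced form of the (untwisted) x-coordinate of `R`. -/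
def PRep {A B : F} (R : (WK A B).Point) (f g : F[X]) : Prop :=
  IsCoprime f g ∧ XCoord R (algebraMap F[X] (RatFunc F) (lam A B * f)) (algebraMap F[X] (RatFunc F) g)

lemma exists_prep {A B : F} (R : (WK A B).Point) : ∃ f g, PRep R f g := by
  rcases R with _ | ⟨x, y, h⟩
  · refine ⟨1, 0, isCoprime_one_left, ?_⟩
    rw [← Point.zero_def, XCoord_zero_iff]
    refine ⟨by simp, ?_⟩
    refine (map_ne_zero_iff _ (RatFunc.algebraMap_injective F)).2 ?_
    simpa using lam_ne_zero A B
  · set z := x / algebraMap F[X] (RatFunc F) (lam A B)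
    have hl : algebraMap F[X] (RatFunc F) (lam A B) ≠ 0 :=
      (map_ne_zero_iff _ (RatFunc.algebraMap_injective F)).2 (lam_ne_zero A B)
    have hd' : algebraMap F[X] (RatFunc F) z.denom ≠ 0 :=
      (map_ne_zero_iff _ (RatFunc.algebraMap_injective F)).2 (RatFunc.denom_ne_zero z)
    refine ⟨z.num, z.denom, RatFunc.isCoprime_num_denom z, ?_⟩
    rw [XCoord_some_iff]
    refine ⟨hd', ?_⟩
    have : x = algebraMap F[X] (RatFunc F) (lam A B) * z := by
      simp only [z]; field_simp
    rw [this, map_mul]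
    nth_rewrite 2 [← RatFunc.num_div_denom z]
    field_simp

lemma xcoord_prop {k : Type} [Field k] {a b : k} {P : (shortWeierstrass k a b).Point} {u v u' v' : k}
    (h : XCoord P u v) (h' : XCoord P u' v') : ∃ c, c ≠ 0 ∧ u = c * u' ∧ v = c * v' := by
  obtain ⟨c, hc, rfl, rfl⟩ := h
  obtain ⟨d, hd, rfl, rfl⟩ := h'
  exact ⟨c / d, div_ne_zero hc hd, by field_simp, by field_simp⟩

lemma xcoord_smul {k : Type} [Field k] {a b : k} {P : (shortWeierstrass k a b).Point} {u v c : k}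
    (h : XCoord P u v) (hc : c ≠ 0) : XCoord P (c * u) (c * v) := by
  obtain ⟨d, hd, rfl, rfl⟩ := h
  exact ⟨c * d, mul_ne_zero hc hd, by ring, by ring⟩

lemma prep_unique {A B : F} {R : (WK A B).Point} {f g f' g' : F[X]} (h : PRep R f g)
    (h' : PRep R f' g') : ∃ d : F, d ≠ 0 ∧ f = C d * f' ∧ g = C d * g' := by
  have hl : algebraMap F[X] (RatFunc F) (lam A B) ≠ 0 :=
    (map_ne_zero_iff _ (RatFunc.algebraMap_injective F)).2 (lam_ne_zero A B)
  obtain ⟨c, hc, h1, h2⟩ := xcoord_prop h.2 h'.2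
  have p : ∀ {f g : F[X]}, IsCoprime f g → Prim3 f g 0 :=
    fun h q hq h1 h2 _ => hq.not_isUnit (h.isUnit_of_dvd' h1 h2)
  obtain ⟨d, hd, e1, e2, -⟩ := prim3_scale (p h.1) (p h'.1) hc
    (by rw [map_mul, map_mul] at h1; apply mul_left_cancel₀ hl; rw [h1]; ring) h2 (by simp)
  exact ⟨d, hd, e1, e2⟩

variable [DecidableEq (RatFunc F)]

lemma prep_par {A B : F} (hΔ : (shortWeierstrass F A B).Δ ≠ 0) {R P : (WK A B).Point}
    (hP : PRep P X 1) {f g f₃ g₃ f₄ g₄ : F[X]}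
    (hR : PRep R f g) (h₃ : PRep (R + P) f₃ g₃) (h₄ : PRep (R - P) f₄ g₄) :
    ∃ c : F, c ≠ 0 ∧ g₃ * g₄ = C c * F0 f g X 1 ∧
      f₃ * g₄ + f₄ * g₃ = C c * F1 (C A) (C B) f g X 1 ∧
      f₃ * f₄ = C c * F2 (C A) (C B) f g X 1 := by
  have hl : algebraMap F[X] (RatFunc F) (lam A B) ≠ 0 :=
    (map_ne_zero_iff _ (RatFunc.algebraMap_injective F)).2 (lam_ne_zero A B)
  obtain ⟨c, hc, e0, e1, e2⟩ := rep_add_sub (WK_Δ hΔ) hR.2 hP.2 h₃.2 h₄.2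
  refine prim3_scale (prim3_left h₃.1 h₄.1) (prim3_right hΔ hR.1)
    (c := c * algebraMap F[X] (RatFunc F) (lam A B) ^ 2) (mul_ne_zero hc (pow_ne_zero _ hl))
    ?_ ?_ ?_
  · simp only [F0, map_mul, map_sub, map_add, map_pow, map_one] at e0 ⊢
    rw [e0]; ring
  · apply mul_left_cancel₀ hl
    simp only [F1, map_mul, map_sub, map_add, map_pow, map_one, map_ofNat] at e1 ⊢
    linear_combination e1
  · apply mul_left_cancel₀ (pow_ne_zero 2 hl)
    simp only [F2, map_mul, map_sub, map_add, map_pow, map_one, map_ofNat] at e2 ⊢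
    linear_combination e2

end ff

section deg
open Polynomial
variable {F : Type} [Field F]

lemma par_degree {A B c : F} (hc : c ≠ 0) {f g f₃ g₃ f₄ g₄ : F[X]} (hg : g.degree < f.degree)
    (h0 : g₃ * g₄ = C c * F0 f g X 1) (h1 : f₃ * g₄ + f₄ * g₃ = C c * F1 (C A) (C B) f g X 1)
    (h2 : f₃ * f₄ = C c * F2 (C A) (C B) f g X 1) :
    f₃.natDegree + f₄.natDegree = 2 * f.natDegree + 2 ∧ g₃.degree < f₃.degree ∧
      g₄.degree < f₄.degree := by
  have hf0 : f ≠ 0 := by rintro rfl; simp at hg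
  have hgd : g.natDegree ≤ f.natDegree := natDegree_le_natDegree hg.le
  have hXg : (X * g).natDegree ≤ f.natDegree := by
    by_cases h : g = 0
    · simp [h]
    · rw [natDegree_X_mul h]
      exact natDegree_lt_natDegree h hg
  set d := f.natDegree with hd
  have hG0 : (F0 f g X 1).natDegree ≤ 2 * d := by
    unfold F0
    refine natDegree_pow_le_of_le 2 ?_
    rw [mul_one]
    exact (natDegree_sub_le_of_le hd.ge hXg).trans (by simp)
  have hG1 : (F1 (C A) (C B) f g X 1).natDegree ≤ 2 * d + 1 := by
    have e : F1 (C A) (C B) f g X 1 = C 2 * ((f + X * g) * (f * X + C A * g) + C (2 * B) * g ^ 2) := by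
      simp only [F1, map_mul, map_ofNat]; ring
    rw [e]
    refine (natDegree_C_mul_le _ _).trans (natDegree_add_le_of_degree_le ?_ ?_)
    · have : 2 * d + 1 = d + (d + 1) := by ring
      rw [this]
      refine natDegree_mul_le_of_le (natDegree_add_le_of_degree_le hd.ge hXg)
        (natDegree_add_le_of_degree_le ?_ ((natDegree_C_mul_le _ _).trans (by omega)))
      exact natDegree_mul_le_of_le hd.ge natDegree_X_le
    · refine (natDegree_C_mul_le _ _).trans ((natDegree_pow_le_of_le 2 hgd).trans (by omega))
  have hG2 : (F2 (C A) (C B) f g X 1).natDegree = 2 * d + 2 := by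
    have e : F2 (C A) (C B) f g X 1 = f ^ 2 * X ^ 2 + (C (-2 * A) * (X * (f * g)) + C (A ^ 2) * g ^ 2
      - C (4 * B) * ((f + X * g) * g)) := by
      simp only [F2, map_mul, map_ofNat, map_pow, map_neg]; ring
    have e1 : (f ^ 2 * X ^ 2).natDegree = 2 * d + 2 := by
      rw [natDegree_mul (pow_ne_zero _ hf0) (pow_ne_zero _ X_ne_zero)]
      simp [hd]
    rw [e, natDegree_add_eq_left_of_natDegree_lt, e1]
    rw [e1]
    refine Nat.lt_succ_of_le ?_
    refine (natDegree_sub_le_of_le (m := 2 * d + 1) (n := 2 * d + 1) (natDegree_add_le_of_degree_le ?_ ?_) ?_).trans (by simp)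
    · refine (natDegree_C_mul_le _ _).trans ((natDegree_mul_le_of_le natDegree_X_le
        (natDegree_mul_le_of_le hd.ge hgd)).trans (by omega))
    · refine (natDegree_C_mul_le _ _).trans ((natDegree_pow_le_of_le 2 hgd).trans (by omega))
    · refine (natDegree_C_mul_le _ _).trans ((natDegree_mul_le_of_le (natDegree_add_le_of_degree_le hd.ge hXg) hgd).trans (by omega))
  have hne : f₃ * f₄ ≠ 0 := by
    rw [h2]
    refine mul_ne_zero (by simpa using hc) ?_
    intro h
    rw [h] at hG2
    simp at hG2
  have hs : f₃.natDegree + f₄.natDegree = 2 * d + 2 := by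
    rw [← natDegree_mul (left_ne_zero_of_mul hne) (right_ne_zero_of_mul hne), h2,
      natDegree_C_mul hc, hG2]
  have h0' : (g₃ * g₄).natDegree ≤ 2 * d := by rw [h0, natDegree_C_mul hc]; exact hG0
  have h1' : (f₃ * g₄ + f₄ * g₃).natDegree ≤ 2 * d + 1 := by rw [h1, natDegree_C_mul hc]; exact hG1
  have key : ∀ {f₃ g₃ f₄ g₄ : F[X]}, f₃ * f₄ ≠ 0 → f₃.natDegree + f₄.natDegree = 2 * d + 2 →
      (g₃ * g₄).natDegree ≤ 2 * d → (f₃ * g₄ + f₄ * g₃).natDegree ≤ 2 * d + 1 →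
      g₃.degree < f₃.degree := by
    intro f₃ g₃ f₄ g₄ hne hs h0 h1
    by_contra hcon
    rw [not_lt] at hcon
    have hf3 := left_ne_zero_of_mul hne
    have hf4 := right_ne_zero_of_mul hne
    have hg3 : g₃ ≠ 0 := by
      rintro rfl
      rw [degree_zero, le_bot_iff, degree_eq_bot] at hcon
      exact hf3 hcon
    have hle := natDegree_le_natDegree hcon
    have hm : (f₄ * g₃).natDegree = f₄.natDegree + g₃.natDegree := natDegree_mul hf4 hg3
    by_cases hg4 : g₄ = 0
    · rw [hg4, mul_zero, zero_add, hm] at h1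
      omega
    · rw [natDegree_mul hg3 hg4] at h0
      have hm' : (f₃ * g₄).natDegree = f₃.natDegree + g₄.natDegree := natDegree_mul hf3 hg4
      rw [natDegree_add_eq_right_of_natDegree_lt (by omega)] at h1
      omega
  exact ⟨hs, key hne hs h0' h1', key (by rwa [mul_comm]) (by omega) (by rwa [mul_comm])
    (by rwa [add_comm])⟩

/-- The degree of a point. -/
noncomputable def dg {A B : F} (R : (WK A B).Point) : ℕ := (exists_prep R).choose.natDegree

lemma dg_eq {A B : F} {R : (WK A B).Point} {f g : F[X]} (h : PRep R f g) : dg R = f.natDegree := by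
  obtain ⟨g', h'⟩ := (exists_prep R).choose_spec
  obtain ⟨d, hd, e, -⟩ := prep_unique h' h
  rw [dg, e, natDegree_C_mul hd]

/-- The denominator has smaller degree than the numerator. -/
def Gap {A B : F} (R : (WK A B).Point) : Prop := ∀ f g, PRep R f g → g.degree < f.degree

lemma gap_of {A B : F} {R : (WK A B).Point} {f g : F[X]} (h : PRep R f g)
    (hg : g.degree < f.degree) : Gap R := by
  intro f' g' h'
  obtain ⟨d, hd, e, e'⟩ := prep_unique h' h
  rw [e, e', degree_C_mul hd, degree_C_mul hd]
  exact hg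

variable [DecidableEq (RatFunc F)] {A B : F}

lemma gap_step (hΔ : (shortWeierstrass F A B).Δ ≠ 0) {R P : (WK A B).Point}
    (hP : PRep P X 1) (hR : Gap R) : Gap (R + P) ∧ Gap (R - P) ∧
      dg (R + P) + dg (R - P) = 2 * dg R + 2 := by
  obtain ⟨f, g, h⟩ := exists_prep R
  obtain ⟨f₃, g₃, h₃⟩ := exists_prep (R + P)
  obtain ⟨f₄, g₄, h₄⟩ := exists_prep (R - P)
  obtain ⟨c, hc, e0, e1, e2⟩ := prep_par hΔ hP h h₃ h₄
  obtain ⟨hs, k3, k4⟩ := par_degree hc (hR f g h) e0 e1 e2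
  exact ⟨gap_of h₃ k3, gap_of h₄ k4, by rw [dg_eq h, dg_eq h₃, dg_eq h₄, hs]⟩

lemma gap_zsmul (hΔ : (shortWeierstrass F A B).Δ ≠ 0) {R P : (WK A B).Point}
    (hP : PRep P X 1) (hR : Gap R) (n : ℤ) : Gap (R + n • P) := by
  induction n using Int.induction_on with
  | zero => simpa using hR
  | succ i ih =>
    rw [add_zsmul, one_zsmul, ← add_assoc]
    exact (gap_step hΔ hP ih).1
  | pred i ih =>
    rw [sub_zsmul, one_zsmul, ← add_assoc, ← sub_eq_add_neg]
    exact (gap_step hΔ hP ih).2.1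

lemma quad_sol {e : ℤ → ℤ} (h : ∀ n, e (n + 1) + e (n - 1) = 2 * e n + 2) (n : ℤ) :
    e n = n ^ 2 + (e 1 - e 0 - 1) * n + e 0 := by
  have key : ∀ n : ℤ, e n = n ^ 2 + (e 1 - e 0 - 1) * n + e 0 ∧
      e (n + 1) = (n + 1) ^ 2 + (e 1 - e 0 - 1) * (n + 1) + e 0 := by
    intro n
    induction n using Int.induction_on with
    | zero => constructor <;> simp
    | succ i ih =>
      refine ⟨ih.2, ?_⟩
      have := h (i + 1)
      rw [add_sub_cancel_right, ih.1, ih.2] at this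
      linear_combination this
    | pred i ih =>
      have := h (-i)
      rw [ih.1, ih.2] at this
      refine ⟨by linear_combination this, ?_⟩
      rw [sub_add_cancel, ih.1]
  exact (key n).1

lemma dg_zsmul (hΔ : (shortWeierstrass F A B).Δ ≠ 0) {R P : (WK A B).Point}
    (hP : PRep P X 1) (hR : Gap R) (n : ℤ) :
    (dg (R + n • P) : ℤ) = n ^ 2 + (dg (R + P) - dg R - 1) * n + dg R := by
  have := quad_sol (e := fun n => (dg (R + n • P) : ℤ)) (fun n => by
    have := (gap_step hΔ hP (gap_zsmul hΔ hP hR n)).2.2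
    simp only [add_zsmul, sub_zsmul, one_zsmul, ← add_assoc, ← add_sub_assoc]
    exact_mod_cast this) n
  simpa using this

lemma alg_ne {f : F[X]} (hf : f ≠ 0) : algebraMap F[X] (RatFunc F) f ≠ 0 :=
  (map_ne_zero_iff _ (RatFunc.algebraMap_injective F)).2 hf

lemma prep_zero : PRep (0 : (WK A B).Point) 1 0 := by
  refine ⟨isCoprime_one_left, ?_⟩
  rw [XCoord_zero_iff]
  exact ⟨by simp, alg_ne (by simpa using lam_ne_zero A B)⟩

lemma gap_zero : Gap (0 : (WK A B).Point) := gap_of prep_zero (by simp)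

/-- The generic point. -/
noncomputable def P0 (hΔ : (shortWeierstrass F A B).Δ ≠ 0) : (WK A B).Point :=
  .some (algebraMap F[X] (RatFunc F) (lam A B * X)) (algebraMap F[X] (RatFunc F) (lam A B ^ 2)) (by
    rw [sw_ns_iff (WK_Δ hΔ)]
    simp only [← map_pow, ← map_mul, ← map_add]
    congr 1
    nth_rewrite 1 [show (lam A B ^ 2) ^ 2 = lam A B ^ 3 * lam A B by ring]
    nth_rewrite 2 [lam]
    ring)

lemma prep_P0 (hΔ : (shortWeierstrass F A B).Δ ≠ 0) : PRep (P0 hΔ) X 1 := by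
  refine ⟨isCoprime_one_right, ?_⟩
  rw [P0, XCoord_some_iff]
  simp

lemma dg_P0 (hΔ : (shortWeierstrass F A B).Δ ≠ 0) (n : ℤ) : (dg (n • P0 hΔ) : ℤ) = n ^ 2 := by
  have := dg_zsmul hΔ (prep_P0 hΔ) gap_zero n
  rw [zero_add, zero_add, dg_eq (prep_P0 hΔ), dg_eq prep_zero] at this
  simpa using this

end deg

section torsion
open Polynomial
variable {F : Type} [Field F] {A B : F} [DecidableEq (RatFunc F)]
  {L : Type} [Field L] [Algebra F L] [DecidableEq L]

lemma L_Δ (hΔ : (shortWeierstrass F A B).Δ ≠ 0) :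
    (shortWeierstrass L (algebraMap F L A) (algebraMap F L B)).Δ ≠ 0 := by
  have : (shortWeierstrass L (algebraMap F L A) (algebraMap F L B)).Δ =
      algebraMap F L (shortWeierstrass F A B).Δ := by
    rw [sw_Δ, sw_Δ]; simp only [map_mul, map_neg, map_add, map_pow, map_ofNat]
  rw [this]
  exact (map_ne_zero_iff _ (algebraMap F L).injective).2 hΔ

lemma rep_mul (hΔ : (shortWeierstrass F A B).Δ ≠ 0) {x y : L} {h} (n : ℕ) {f g : F[X]}
    (hfg : PRep (n • P0 hΔ) f g) :
    XCoord (n • (.some x y h : (shortWeierstrass L (algebraMap F L A) (algebraMap F L B)).Point))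
      (aeval x f) (aeval x g) := by
  set P : (shortWeierstrass L (algebraMap F L A) (algebraMap F L B)).Point := .some x y h with hPdef
  have hP : XCoord P x 1 := by rw [hPdef, XCoord_some_iff]; simp
  have sc : ∀ {R : (WK A B).Point} {Q : (shortWeierstrass L (algebraMap F L A) (algebraMap F L B)).Point}
      {f g f' g' : F[X]}, PRep R f g → PRep R f' g' → XCoord Q (aeval x f) (aeval x g) →
      XCoord Q (aeval x f') (aeval x g') := by
    intro R Q f g f' g' h h' hQ
    obtain ⟨d, hd, e, e'⟩ := prep_unique h' h
    have := xcoord_smul hQ (c := algebraMap F L d) ((map_ne_zero_iff _ (algebraMap F L).injective).2 hd)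
    simpa [e, e'] using this
  have key : ∀ n : ℕ, (∀ f g, PRep (n • P0 hΔ) f g → XCoord (n • P) (aeval x f) (aeval x g)) ∧
      (∀ f g, PRep ((n + 1) • P0 hΔ) f g → XCoord ((n + 1) • P) (aeval x f) (aeval x g)) := by
    intro n
    induction n with
    | zero =>
      refine ⟨fun f g h => ?_, fun f g h => ?_⟩
      · rw [zero_nsmul] at h ⊢
        refine sc prep_zero h ?_
        rw [XCoord_zero_iff]; simp
      · rw [zero_add, one_nsmul] at h ⊢
        refine sc (prep_P0 hΔ) h ?_
        simpa using hP
    | succ m ih =>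
      refine ⟨ih.2, fun f₃ g₃ h₃ => ?_⟩
      obtain ⟨f, g, hR⟩ := exists_prep ((m + 1) • P0 hΔ)
      obtain ⟨f₄, g₄, h₄⟩ := exists_prep (m • P0 hΔ)
      have i1 := ih.2 f g hR
      have i4 := ih.1 f₄ g₄ h₄
      obtain ⟨u, v, i3⟩ := exists_rep ((m + 1 + 1) • P)
      have a3 : (m + 1 + 1) • P0 hΔ = (m + 1) • P0 hΔ + P0 hΔ := succ_nsmul _ _
      have a4 : m • P0 hΔ = (m + 1) • P0 hΔ - P0 hΔ := by rw [succ_nsmul, add_sub_cancel_right]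
      have b3 : (m + 1 + 1) • P = (m + 1) • P + P := succ_nsmul _ _
      have b4 : m • P = (m + 1) • P - P := by rw [succ_nsmul, add_sub_cancel_right]
      obtain ⟨c, hc, e0, e1, e2⟩ := prep_par hΔ (prep_P0 hΔ) hR (a3 ▸ h₃) (a4 ▸ h₄)
      obtain ⟨d, hd, s0, s1, s2⟩ := rep_add_sub (L_Δ hΔ) i1 hP (b3 ▸ i3) (b4 ▸ i4)
      have hc' : algebraMap F L c ≠ 0 := (map_ne_zero_iff _ (algebraMap F L).injective).2 hc
      have E0 := congrArg (aeval x) e0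
      have E1 := congrArg (aeval x) e1
      have E2 := congrArg (aeval x) e2
      simp only [F0, F1, F2, map_mul, map_add, map_sub, map_pow, map_one, map_ofNat, aeval_X, aeval_C]
        at E0 E1 E2 s0 s1 s2
      set κ := algebraMap F L c / d with hκ
      have hκ0 : κ ≠ 0 := div_ne_zero hc' hd
      have hκd : algebraMap F L c = κ * d := by rw [hκ]; field_simp
      rw [hκd] at E0 E1 E2
      have T0 : aeval x g₃ * aeval x g₄ = κ * (v * aeval x g₄) := by rw [E0, s0]; ring
      have T1 : aeval x f₃ * aeval x g₄ + aeval x f₄ * aeval x g₃ =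
          κ * (u * aeval x g₄ + aeval x f₄ * v) := by rw [E1, s1]; ring
      have T2 : aeval x f₃ * aeval x f₄ = κ * (u * aeval x f₄) := by rw [E2, s2]; ring
      have fin : aeval x f₃ = κ * u ∧ aeval x g₃ = κ * v := by
        by_cases hg4 : aeval x g₄ = 0
        · have hf4 : aeval x f₄ ≠ 0 := by
            obtain ⟨r, s, hrs⟩ := h₄.1
            intro hf4
            have := congrArg (aeval x) hrs
            simp [hf4, hg4] at this
          refine ⟨mul_right_cancel₀ hf4 (by rw [T2]; ring), mul_right_cancel₀ hf4 ?_⟩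
          rw [hg4] at T1
          linear_combination T1
        · have hv : aeval x g₃ = κ * v := mul_right_cancel₀ hg4 (by rw [T0]; ring)
          refine ⟨mul_right_cancel₀ hg4 ?_, hv⟩
          rw [hv] at T1
          linear_combination T1
      rw [fin.1, fin.2]
      exact xcoord_smul i3 hκ0
  exact (key n).1 f g hfg

lemma torsion_card (hΔ : (shortWeierstrass F A B).Δ ≠ 0) {n : ℕ} (hn : n ≠ 0)
    (T : Finset (shortWeierstrass L (algebraMap F L A) (algebraMap F L B)).Point)
    (hT : ∀ P ∈ T, n • P = 0) : T.card ≤ 2 * n ^ 2 := by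
  classical
  obtain ⟨f, g, hfg⟩ := exists_prep (n • P0 hΔ)
  have hdf : f.natDegree = n ^ 2 := by
    have := dg_P0 hΔ n
    rw [natCast_zsmul, dg_eq hfg] at this
    exact_mod_cast this
  have hn2 : 0 < n ^ 2 := by positivity
  have hgap : g.degree < f.degree := by
    have := gap_zsmul hΔ (prep_P0 hΔ) gap_zero n
    rw [zero_add, natCast_zsmul] at this
    exact this f g hfg
  have hg0 : g ≠ 0 := by
    rintro rfl
    have := natDegree_eq_zero_of_isUnit (isCoprime_zero_right.1 hfg.1)
    omega
  have hgd : g.natDegree < n ^ 2 := by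
    rw [← hdf]; exact natDegree_lt_natDegree hg0 hgap
  set G := g.map (algebraMap F L) with hG
  have hG0 : G ≠ 0 := (Polynomial.map_ne_zero_iff (algebraMap F L).injective).2 hg0
  set xs := G.roots.toFinset with hxs
  have hxc : xs.card ≤ g.natDegree := by
    refine (Multiset.toFinset_card_le _).trans ((card_roots' G).trans ?_)
    rw [hG, natDegree_map]
  have hroot : ∀ x y h, n • (.some x y h : (shortWeierstrass L (algebraMap F L A) (algebraMap F L B)).Point) = 0 → x ∈ xs := by
    intro x y h h0
    have := rep_mul hΔ (h := h) n hfg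
    rw [h0, XCoord_zero_iff] at this
    rw [hxs, Multiset.mem_toFinset, mem_roots hG0, IsRoot.def, hG, eval_map_algebraMap]
    exact this.1
  have h1 : T.card ≤ 2 * (T.image (fun P => P.xRep)).card := by
    refine Finset.card_le_mul_card_image T 2 ?_
    intro r hr
    obtain ⟨P, hP, rfl⟩ := Finset.mem_image.1 hr
    refine (Finset.card_le_card (t := {P, -P}) ?_).trans Finset.card_le_two
    intro Q hQ
    rw [Finset.mem_filter] at hQ
    simpa using Point.eq_or_eq_neg_of_xRep_eq_xRep hQ.2
  have h2 : T.image (fun P => P.xRep) ⊆ insert ![1, 0] (xs.image (fun x => ![x, 1])) := by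
    intro r hr
    obtain ⟨P, hP, rfl⟩ := Finset.mem_image.1 hr
    rcases P with _ | ⟨x, y, h⟩
    · rw [← Point.zero_def]; simp
    · simp only [Finset.mem_insert, Finset.mem_image]
      exact Or.inr ⟨x, hroot x y h (hT _ hP), by simp⟩
  have h3 := (Finset.card_le_card h2).trans ((Finset.card_insert_le _ _).trans
    (Nat.add_le_add_right Finset.card_image_le 1))
  omega

end torsion

section hasse0
open Polynomial

lemma xcoord_add_ne {k : Type} [Field k] [DecidableEq k] {a b : k} {x₁ y₁ x₂ y₂ : k} {h₁ h₂} (hx : x₁ ≠ x₂) :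
    XCoord ((.some x₁ y₁ h₁ + .some x₂ y₂ h₂ : (shortWeierstrass k a b).Point))
      ((y₁ - y₂) ^ 2 - (x₁ + x₂) * (x₁ - x₂) ^ 2) ((x₁ - x₂) ^ 2) := by
  rw [Point.add_of_X_ne hx, XCoord_some_iff]
  have : x₁ - x₂ ≠ 0 := sub_ne_zero.2 hx
  refine ⟨pow_ne_zero _ this, ?_⟩
  rw [sw_addX, slope_of_X_ne hx]
  field_simp
  ring

variable {p : ℕ} [Fact p.Prime] {A B : ZMod p} [DecidableEq (RatFunc (ZMod p))]

lemma lam_frob : lam A B ^ p = X ^ (3 * p) + C A * X ^ p + C B := by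
  rw [lam, add_pow_char, add_pow_char, mul_pow, ← C_pow, ← C_pow, ZMod.pow_card, ZMod.pow_card, ← pow_mul]

/-- The Frobenius point. -/
noncomputable def PQ (hp : p = 2 * (p / 2) + 1) (hΔ : (shortWeierstrass (ZMod p) A B).Δ ≠ 0) : (WK A B).Point :=
  .some (algebraMap _ (RatFunc (ZMod p)) (lam A B * X ^ p))
    (algebraMap _ (RatFunc (ZMod p)) (lam A B ^ 2 * lam A B ^ (p / 2))) (by
    rw [sw_ns_iff (WK_Δ hΔ)]
    simp only [← map_pow, ← map_mul, ← map_add]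
    congr 1
    have h : lam A B * lam A B ^ (p / 2) * lam A B ^ (p / 2) = X ^ (3 * p) + C A * X ^ p + C B := by
      have e : ∀ n, n = 2 * (p / 2) + 1 → lam A B ^ n = lam A B * lam A B ^ (p / 2) * lam A B ^ (p / 2) := by
        rintro n rfl
        ring
      rw [← lam_frob, e p hp]
    linear_combination (lam A B ^ 3) * h)

lemma prep_PQ (hp : p = 2 * (p / 2) + 1) (hΔ : (shortWeierstrass (ZMod p) A B).Δ ≠ 0) :
    PRep (PQ hp hΔ) (X ^ p) 1 := by
  refine ⟨isCoprime_one_right, ?_⟩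
  rw [PQ, XCoord_some_iff]
  simp

/-- Numerator. -/
noncomputable def nm (A B : ZMod p) : (ZMod p)[X] :=
  lam A B * (lam A B ^ (p / 2) + 1) ^ 2 - (X ^ p + X) * (X ^ p - X) ^ 2

lemma frob_sub_ne : (X ^ p - X : (ZMod p)[X]) ≠ 0 :=
  FiniteField.X_pow_card_sub_X_ne_zero _ (Fact.out : p.Prime).one_lt

lemma xcoord_diff (hp : p = 2 * (p / 2) + 1) (hΔ : (shortWeierstrass (ZMod p) A B).Δ ≠ 0) :
    XCoord (PQ hp hΔ - P0 hΔ) (algebraMap (ZMod p)[X] (RatFunc (ZMod p)) (lam A B * nm A B))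
      (algebraMap (ZMod p)[X] (RatFunc (ZMod p)) ((X ^ p - X) ^ 2)) := by
  rw [sub_eq_add_neg, PQ, P0, Point.neg_some]
  have hne : algebraMap (ZMod p)[X] (RatFunc (ZMod p)) (lam A B * X ^ p) ≠
      algebraMap (ZMod p)[X] (RatFunc (ZMod p)) (lam A B * X) := by
    intro h
    have := mul_left_cancel₀ (lam_ne_zero A B) (RatFunc.algebraMap_injective _ h)
    exact frob_sub_ne (sub_eq_zero.2 this)
  have hl := alg_ne (lam_ne_zero A B)
  have key : ∀ {P : (WK A B).Point} {u v u' v' : RatFunc (ZMod p)}, XCoord P u v →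
      u = algebraMap (ZMod p)[X] _ (lam A B) ^ 2 * u' → v = algebraMap (ZMod p)[X] _ (lam A B) ^ 2 * v' → XCoord P u' v' := by
    intro P u v u' v' h e e'
    have := xcoord_smul h (inv_ne_zero (pow_ne_zero 2 hl))
    rw [e, e', inv_mul_cancel_left₀ (pow_ne_zero 2 hl), inv_mul_cancel_left₀ (pow_ne_zero 2 hl)] at this
    exact this
  refine key (xcoord_add_ne hne) ?_ ?_
  · rw [sw_negY, nm]
    simp only [map_mul, map_pow, map_add, map_sub, map_one]
    ring
  · simp only [map_mul, map_pow, map_sub]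
    ring

lemma nm_natDegree (hp : p = 2 * (p / 2) + 1) : (nm A B).natDegree = 2 * p + 1 := by
  have e : ∀ n, n = 2 * (p / 2) + 1 → lam A B ^ n = lam A B * lam A B ^ (p / 2) * lam A B ^ (p / 2) := by
    rintro n rfl
    ring
  have h3 : 3 ≤ p := by
    have := (Fact.out : p.Prime).two_le
    omega
  have h : nm A B = X ^ (2 * p + 1) + (C A * X ^ p + C B + 2 * lam A B ^ (p / 2 + 1) + lam A B + X ^ (p + 2) - X ^ 3) := by
    have := (e p hp).symm.trans lam_frob
    rw [nm]
    linear_combination this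
  rw [h, natDegree_add_eq_left_of_natDegree_lt, natDegree_X_pow]
  rw [natDegree_X_pow, Nat.lt_succ_iff]
  have hl : (lam A B ^ (p / 2 + 1)).natDegree ≤ 2 * p := by
    refine natDegree_pow_le.trans ?_
    rw [lam_natDegree]; omega
  refine (natDegree_sub_le _ _).trans (max_le ?_ ?_)
  · refine natDegree_add_le_of_degree_le (natDegree_add_le_of_degree_le (natDegree_add_le_of_degree_le (natDegree_add_le_of_degree_le ?_ ?_) ?_) ?_) ?_
    · refine (natDegree_C_mul_X_pow_le _ _).trans (by omega)
    · simp
    · rw [show (2 : (ZMod p)[X]) = C 2 from (map_ofNat C 2).symm]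
      exact (natDegree_C_mul_le _ _).trans hl
    · rw [lam_natDegree]; omega
    · rw [natDegree_X_pow]; omega
  · rw [natDegree_X_pow]; omega

/-- number of points above `a`. -/
noncomputable def mm (A B a : ZMod p) : ℕ := (Finset.univ.filter fun y : ZMod p => y ^ 2 = (lam A B).eval a).card

lemma mm_eq (hp : p = 2 * (p / 2) + 1) (a : ZMod p) : (mm A B a : ℤ) = quadraticChar (ZMod p) ((lam A B).eval a) + 1 := by
  have : ringChar (ZMod p) ≠ 2 := by rw [ZMod.ringChar_zmod_n]; omega
  rw [← quadraticChar_card_sqrts this, mm]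
  congr 2
  ext; simp

lemma mm_cases (hp : p = 2 * (p / 2) + 1) (a : ZMod p) :
    (mm A B a = 1 ∧ (lam A B).eval a = 0) ∨ (mm A B a = 2 ∧ (lam A B).eval a ≠ 0 ∧ (lam A B).eval a ^ (p / 2) = 1) ∨
      (mm A B a = 0 ∧ (lam A B).eval a ≠ 0 ∧ (lam A B).eval a ^ (p / 2) = -1) := by
  have hc : ringChar (ZMod p) ≠ 2 := by rw [ZMod.ringChar_zmod_n]; omega
  have h := mm_eq (A := A) (B := B) hp a
  have e := quadraticChar_eq_pow_of_char_ne_two' hc ((lam A B).eval a)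
  rw [ZMod.card] at e
  by_cases h0 : (lam A B).eval a = 0
  · left; rw [h0] at h; simp at h; exact ⟨by exact_mod_cast h, h0⟩
  · right
    rcases quadraticChar_dichotomy h0 with h1 | h1
    · left; rw [h1] at h e; refine ⟨by omega, h0, ?_⟩; rw [← e]; simp
    · right; rw [h1] at h e; refine ⟨by omega, h0, ?_⟩; rw [← e]; simp

lemma frob_prod : (X ^ p - X : (ZMod p)[X]) = ∏ a : ZMod p, (X - C a) := by
  have h := FiniteField.roots_X_pow_card_sub_X (ZMod p)
  rw [ZMod.card] at h
  have h1 := (Fact.out : p.Prime).one_lt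
  have hm : (X ^ p - X : (ZMod p)[X]).Monic := by
    refine monic_X_pow_sub ?_
    rw [degree_X]; exact_mod_cast h1
  have := prod_multiset_X_sub_C_of_monic_of_roots_card_eq hm (by
    rw [h, FiniteField.X_pow_card_sub_X_natDegree_eq _ h1]; simp [ZMod.card])
  rw [← this, h]
  rfl

lemma sq_not_dvd (hΔ : (shortWeierstrass (ZMod p) A B).Δ ≠ 0) (a : ZMod p) : ¬ (X - C a) ^ 2 ∣ lam A B := by
  rintro ⟨c, hc⟩
  refine not_isUnit_X_sub_C a (isUnit_of_dvd_disc hΔ (q := X - C a) ?_ ?_)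
  · rw [hc]; exact Dvd.intro ((X - C a) * c) (by ring)
  · have hd := congrArg derivative hc
    have h1 : derivative (lam A B) = 3 * X ^ 2 + C A := by
      rw [lam]; simp; rw [show (C 2 : (ZMod p)[X]) = 2 from map_ofNat C 2]; norm_num
    rw [h1] at hd
    have h2 : X - C a ∣ 3 * X ^ 2 + C A := by
      rw [hd]
      simp only [derivative_mul, derivative_pow]
      refine dvd_add ?_ ?_
      · refine Dvd.dvd.mul_right (Dvd.dvd.mul_right (Dvd.dvd.mul_left ?_ _) _) _; simp
      · exact Dvd.dvd.mul_right (dvd_pow_self _ two_ne_zero) _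
    have h3 : X - C a ∣ lam A B := by rw [hc]; exact Dvd.intro ((X - C a) * c) (by ring)
    have : (X ^ 2 - C A) ^ 2 - 8 * C B * X = (3 * X ^ 2 + C A) * (3 * X ^ 2 + C A) - lam A B * (8 * X) := by
      rw [lam]; ring
    rw [this]
    exact dvd_sub (h2.mul_right _) (h3.mul_right _)


lemma prep_diff (hp : p = 2 * (p / 2) + 1) (hΔ : (shortWeierstrass (ZMod p) A B).Δ ≠ 0) :
    ∃ f g, PRep (PQ hp hΔ - P0 hΔ) f g ∧ f.natDegree = 1 + ∑ a, mm A B a := by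
  have hm2 : ∀ a, mm A B a ≤ 2 := fun a => by
    rcases mm_cases (A := A) (B := B) hp a with h | h | h <;> omega
  have h2 : p / 2 ≠ 0 := by have := (Fact.out : p.Prime).two_le; omega
  have hfr : ∀ a : ZMod p, X - C a ∣ X ^ p - X := fun a => by
    rw [frob_prod]; exact Finset.dvd_prod_of_mem _ (Finset.mem_univ a)
  have hev : ∀ a : ZMod p, (nm A B).eval a = (lam A B).eval a * ((lam A B).eval a ^ (p / 2) + 1) ^ 2 := fun a => by
    simp [nm, ZMod.pow_card]
  set D : (ZMod p)[X] := ∏ a : ZMod p, (X - C a) ^ (2 - mm A B a) with hD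
  set g : (ZMod p)[X] := ∏ a : ZMod p, (X - C a) ^ (mm A B a) with hg
  have hDg : D * g = (X ^ p - X) ^ 2 := by
    rw [hD, hg, ← Finset.prod_mul_distrib, frob_prod, ← Finset.prod_pow]
    refine Finset.prod_congr rfl fun a _ => ?_
    rw [← pow_add, Nat.sub_add_cancel (hm2 a)]
  have hdvd : D ∣ nm A B := by
    refine Fintype.prod_dvd_of_coprime ?_ ?_
    · intro a b hab
      exact (pairwise_coprime_X_sub_C Function.injective_id hab).pow
    · intro a
      rcases mm_cases (A := A) (B := B) hp a with ⟨h, h0⟩ | ⟨h, -⟩ | ⟨h, -, h1⟩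
      · rw [h, nm, show 2 - 1 = 1 from rfl, pow_one]
        refine dvd_sub (Dvd.dvd.mul_right (dvd_iff_isRoot.2 h0) _) (Dvd.dvd.mul_left ?_ _)
        exact dvd_pow (hfr a) two_ne_zero
      · simp [h]
      · rw [h, nm, Nat.sub_zero]
        refine dvd_sub (Dvd.dvd.mul_left (pow_dvd_pow_of_dvd (dvd_iff_isRoot.2 ?_) 2) _)
          (Dvd.dvd.mul_left (pow_dvd_pow_of_dvd (hfr a) 2) _)
        simp [IsRoot, h1]
  obtain ⟨f, hf⟩ := hdvd
  have hnm0 : nm A B ≠ 0 := by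
    intro h
    have := nm_natDegree (A := A) (B := B) hp
    rw [h] at this; simp at this
  have hf0 : f ≠ 0 := by rintro rfl; simp at hf; exact hnm0 hf
  have hDm : D.Monic := monic_prod_of_monic _ _ fun a _ => (monic_X_sub_C a).pow _
  have hroot : ∀ a, mm A B a ≠ 0 → f.eval a ≠ 0 := by
    intro a hma hfa
    rcases mm_cases (A := A) (B := B) hp a with ⟨h, h0⟩ | ⟨h, h0, h1⟩ | ⟨h, -⟩
    · have d1 : X - C a ∣ D := by
        have := Finset.dvd_prod_of_mem (fun a => (X - C a : (ZMod p)[X]) ^ (2 - mm A B a)) (Finset.mem_univ a)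
        simpa [h] using this
      have d2 : (X - C a) ^ 2 ∣ nm A B := by
        rw [hf, sq]; exact mul_dvd_mul d1 (dvd_iff_isRoot.2 hfa)
      have d3 : (X - C a) ^ 2 ∣ lam A B * (lam A B ^ (p / 2) + 1) ^ 2 := by
        have := dvd_add d2 (Dvd.dvd.mul_left (pow_dvd_pow_of_dvd (hfr a) 2) (X ^ p + X))
        rwa [nm, sub_add_cancel] at this
      refine sq_not_dvd hΔ a (IsCoprime.dvd_of_dvd_mul_right (IsCoprime.pow ?_) d3)
      refine ((irreducible_X_sub_C a).coprime_iff_not_dvd).2 ?_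
      rw [dvd_iff_isRoot]
      simp [IsRoot, h0, h2]
    · have := hev a
      rw [hf, eval_mul, hfa, h1, mul_zero] at this
      have h4 := two_ne hΔ
      refine mul_ne_zero h0 (pow_ne_zero 2 ?_) this.symm
      rwa [one_add_one_eq_two]
    · exact hma h
  refine ⟨f, g, ⟨?_, ?_⟩, ?_⟩
  · refine IsCoprime.prod_right fun a _ => ?_
    by_cases hma : mm A B a = 0
    · rw [hma, pow_zero]; exact isCoprime_one_right
    · refine IsCoprime.pow_right (IsCoprime.symm (((irreducible_X_sub_C a).coprime_iff_not_dvd).2 ?_))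
      rw [dvd_iff_isRoot]
      exact hroot a hma
  · have h := xcoord_diff hp hΔ
    have hDn := alg_ne hDm.ne_zero
    have := xcoord_smul h (inv_ne_zero hDn)
    rw [hf, ← hDg, show lam A B * (D * f) = D * (lam A B * f) by ring, map_mul _ D, map_mul _ D,
      inv_mul_cancel_left₀ hDn, inv_mul_cancel_left₀ hDn] at this
    exact this
  · have e1 := nm_natDegree (A := A) (B := B) hp
    rw [hf, hDm.natDegree_mul' hf0] at e1
    have e2 : D.natDegree = ∑ a, (2 - mm A B a) := by
      rw [hD, natDegree_prod_of_monic _ _ fun a _ => (monic_X_sub_C a).pow _]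
      refine Finset.sum_congr rfl fun a _ => ?_
      rw [natDegree_pow, natDegree_X_sub_C, mul_one]
    have e3 : ∑ a, (2 - mm A B a) + ∑ a, mm A B a = 2 * p := by
      rw [← Finset.sum_add_distrib, Finset.sum_congr rfl fun a _ => Nat.sub_add_cancel (hm2 a)]
      simp [ZMod.card, mul_comm]
    omega

lemma card_point (hΔ : (shortWeierstrass (ZMod p) A B).Δ ≠ 0) :
    Finite (shortWeierstrass (ZMod p) A B).Point ∧
    Nat.card (shortWeierstrass (ZMod p) A B).Point = 1 + ∑ a, mm A B a := by
  have e : (shortWeierstrass (ZMod p) A B).Point ≃ Option (Σ a : ZMod p, {y : ZMod p // y ^ 2 = (lam A B).eval a}) := by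
    refine (nonsingularPointEquiv _).trans (Equiv.optionCongr ?_)
    refine (Equiv.subtypeEquivProp (q := fun xy : ZMod p × ZMod p => xy.2 ^ 2 = (lam A B).eval xy.1) ?_).trans ?_
    · funext xy
      rw [sw_ns_iff hΔ]; simp [lam]
    · exact Equiv.subtypeProdEquivSigmaSubtype (fun x y : ZMod p => y ^ 2 = (lam A B).eval x)
  refine ⟨Finite.of_equiv _ e.symm, ?_⟩
  rw [Nat.card_congr e, Nat.card_eq_fintype_card, Fintype.card_option, Fintype.card_sigma, add_comm]
  congr 1
  refine Finset.sum_congr rfl fun a _ => ?_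
  rw [Fintype.card_subtype, mm]

lemma hasse (hp : p = 2 * (p / 2) + 1) (hΔ : (shortWeierstrass (ZMod p) A B).Δ ≠ 0) :
    ((Nat.card (shortWeierstrass (ZMod p) A B).Point : ℤ) - p - 1) ^ 2 ≤ 4 * p := by
  obtain ⟨f, g, hfg, hdeg⟩ := prep_diff hp hΔ
  rw [← (card_point hΔ).2] at hdeg
  set N := Nat.card (shortWeierstrass (ZMod p) A B).Point
  have hgap : Gap (PQ hp hΔ) := gap_of (prep_PQ hp hΔ) (by
    rw [degree_one, degree_X_pow]; exact_mod_cast (Fact.out : p.Prime).pos)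
  have hz := dg_zsmul hΔ (prep_P0 hΔ) hgap
  have hQ : dg (PQ hp hΔ) = p := by rw [dg_eq (prep_PQ hp hΔ), natDegree_X_pow]
  have h1 := hz (-1)
  rw [neg_one_zsmul, ← sub_eq_add_neg, dg_eq hfg, hdeg, hQ] at h1
  set b : ℤ := (dg (PQ hp hΔ + P0 hΔ) : ℤ) - p - 1 with hb
  have hN : (N : ℤ) - p - 1 = - b := by linarith
  rw [hN, neg_sq]
  have hpos : ∀ n : ℤ, 0 ≤ n ^ 2 + b * n + p := fun n => by
    have := hz n
    rw [hQ, ← hb] at this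
    rw [← this]; positivity
  rcases Int.even_or_odd' b with ⟨c, hc | hc⟩
  · have := hpos (-c)
    rw [hc] at this ⊢
    nlinarith
  · have h3 := hpos (-c)
    rw [hc] at h3 ⊢
    have h4 : c * (c + 1) ≤ p := by nlinarith
    have h5 : Even (c * (c + 1)) := Int.even_mul_succ_self c
    obtain ⟨d, hd⟩ := h5
    have : c * (c + 1) ≠ p := by rw [hd]; omega
    have : c * (c + 1) + 1 ≤ p := by omega
    nlinarith

end hasse0

section scale
variable {k : Type} [Field k] [DecidableEq k] {L : Type} [Field L] [DecidableEq L]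
  {a b : k} {a' b' : L}

/-- The map `(x, y) ↦ (u² x, u³ y)`. -/
def scFun (φ : k →+* L) (u : L) (hΔ : (shortWeierstrass k a b).Δ ≠ 0) (hΔ' : (shortWeierstrass L a' b').Δ ≠ 0)
    (ha : a' = u ^ 4 * φ a) (hb : b' = u ^ 6 * φ b) :
    (shortWeierstrass k a b).Point → (shortWeierstrass L a' b').Point
  | .zero => 0
  | .some x y h => .some (u ^ 2 * φ x) (u ^ 3 * φ y) (by
      rw [sw_ns_iff hΔ] at h
      rw [sw_ns_iff hΔ', ha, hb]
      have := congrArg φ h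
      simp only [map_pow, map_add, map_mul] at this
      linear_combination u ^ 6 * this)

lemma some_eq {x y x' y' : L} {h h'} (hx : x = x') (hy : y = y') :
    (.some x y h : (shortWeierstrass L a' b').Point) = .some x' y' h' := by
  subst hx hy; rfl

/-- The map `(x, y) ↦ (u² x, u³ y)` as a homomorphism. -/
def scHom (φ : k →+* L) (u : L) (hu : u ≠ 0) (hΔ : (shortWeierstrass k a b).Δ ≠ 0)
    (hΔ' : (shortWeierstrass L a' b').Δ ≠ 0)
    (ha : a' = u ^ 4 * φ a) (hb : b' = u ^ 6 * φ b) :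
    (shortWeierstrass k a b).Point →+ (shortWeierstrass L a' b').Point where
  toFun := scFun φ u hΔ hΔ' ha hb
  map_zero' := rfl
  map_add' := by
    rintro (_ | ⟨x₁, y₁, h₁⟩) (_ | ⟨x₂, y₂, h₂⟩)
    · change scFun φ u hΔ hΔ' ha hb (0 + 0) = 0 + 0
      rw [add_zero, add_zero]; rfl
    · change scFun φ u hΔ hΔ' ha hb (0 + _) = 0 + _
      rw [zero_add, zero_add]
    · change scFun φ u hΔ hΔ' ha hb (_ + 0) = _ + 0
      rw [add_zero, add_zero]
    · have hφ := φ.injective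
      by_cases hxy : x₁ = x₂ ∧ y₁ = (shortWeierstrass k a b).negY x₂ y₂
      · rw [Point.add_of_Y_eq hxy.1 hxy.2]
        simp only [scFun]
        have e1 : u ^ 2 * φ x₁ = u ^ 2 * φ x₂ := by rw [hxy.1]
        have e2 : u ^ 3 * φ y₁ = (shortWeierstrass L a' b').negY (u ^ 2 * φ x₂) (u ^ 3 * φ y₂) := by
          rw [hxy.2, sw_negY, sw_negY, map_neg]; ring
        rw [Point.add_of_Y_eq e1 e2]
      · have hxy' : ¬ (u ^ 2 * φ x₁ = u ^ 2 * φ x₂ ∧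
            u ^ 3 * φ y₁ = (shortWeierstrass L a' b').negY (u ^ 2 * φ x₂) (u ^ 3 * φ y₂)) := by
          rintro ⟨e1, e2⟩
          refine hxy ⟨hφ (mul_left_cancel₀ (pow_ne_zero 2 hu) e1), ?_⟩
          rw [sw_negY] at e2 ⊢
          refine hφ (mul_left_cancel₀ (pow_ne_zero 3 hu) (e2.trans ?_))
          rw [map_neg]; ring
        rw [Point.add_some hxy]
        simp only [scFun]
        rw [Point.add_some hxy']
        have hs : (shortWeierstrass L a' b').slope (u ^ 2 * φ x₁) (u ^ 2 * φ x₂) (u ^ 3 * φ y₁) (u ^ 3 * φ y₂) =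
            u * φ ((shortWeierstrass k a b).slope x₁ x₂ y₁ y₂) := by
          by_cases hx : x₁ = x₂
          · have hy : y₁ ≠ (shortWeierstrass k a b).negY x₂ y₂ := fun h => hxy ⟨hx, h⟩
            rw [slope_of_Y_ne hx hy, slope_of_Y_ne (by rw [hx]) (fun h => hxy' ⟨by rw [hx], h⟩)]
            have hn : y₁ + y₁ ≠ 0 := by
              have h1' := (sw_ns_iff hΔ).1 h₁
              have h2' := (sw_ns_iff hΔ).1 h₂
              rw [hx, ← h2'] at h1'
              rw [sw_negY] at hy
              have : (y₁ - y₂) * (y₁ + y₂) = 0 := by linear_combination h1'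
              rcases mul_eq_zero.1 this with h | h
              · rw [sub_eq_zero] at h
                intro h'
                exact hy (by rw [← h]; exact eq_neg_of_add_eq_zero_left h')
              · exact absurd (eq_neg_of_add_eq_zero_left h) hy
            have hn' : φ y₁ + φ y₁ ≠ 0 := by
              rw [← map_add]; exact (map_ne_zero_iff _ hφ).2 hn
            rw [sw_negY, sw_negY, sub_neg_eq_add, sub_neg_eq_add]
            simp only [shortWeierstrass, map_div₀, map_add, map_sub, map_mul, map_pow, map_ofNat, map_zero]
            rw [ha, show u ^ 3 * φ y₁ + u ^ 3 * φ y₁ = u ^ 3 * (φ y₁ + φ y₁) by ring]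
            field_simp
            ring
          · rw [slope_of_X_ne hx, slope_of_X_ne fun h => hx (hφ (mul_left_cancel₀ (pow_ne_zero 2 hu) h))]
            have : φ x₁ - φ x₂ ≠ 0 := sub_ne_zero.2 fun h => hx (hφ h)
            simp only [map_div₀, map_sub]
            field_simp
        refine some_eq ?_ ?_
        · rw [hs, sw_addX, sw_addX]
          simp only [map_sub, map_pow]; ring
        · rw [hs]
          simp only [addY, negAddY, sw_negY, sw_addX, map_sub, map_pow, map_neg, map_add, map_mul]; ring

lemma scHom_some {φ : k →+* L} {u : L} (hu : u ≠ 0) (hΔ : (shortWeierstrass k a b).Δ ≠ 0)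
    (hΔ' : (shortWeierstrass L a' b').Δ ≠ 0)
    (ha : a' = u ^ 4 * φ a) (hb : b' = u ^ 6 * φ b) (x y : k) (h) : ∃ h',
    scHom φ u hu hΔ hΔ' ha hb (.some x y h) = .some (u ^ 2 * φ x) (u ^ 3 * φ y) h' := ⟨_, rfl⟩

lemma scHom_inj {φ : k →+* L} {u : L} (hu : u ≠ 0) (hΔ : (shortWeierstrass k a b).Δ ≠ 0)
    (hΔ' : (shortWeierstrass L a' b').Δ ≠ 0)
    (ha : a' = u ^ 4 * φ a) (hb : b' = u ^ 6 * φ b) : Function.Injective (scHom φ u hu hΔ hΔ' ha hb) := by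
  rw [injective_iff_map_eq_zero]
  rintro (_ | ⟨x, y, h⟩) e
  · rfl
  · obtain ⟨h', e'⟩ := scHom_some hu hΔ hΔ' ha hb x y h
    rw [e'] at e
    exact absurd e (Point.some_ne_zero _)
end scale

section fin
variable {p : ℕ} [Fact p.Prime] {A B : ZMod p}
open Polynomial

lemma alpha_ne {α : ZMod p} (hα : ¬ IsSquare α) : α ≠ 0 := by
  rintro rfl; exact hα (IsSquare.zero)

lemma twist_Δ {α : ZMod p} (hα : α ≠ 0) (hΔ : (shortWeierstrass (ZMod p) A B).Δ ≠ 0) :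
    (shortWeierstrass (ZMod p) ((α ^ 2)⁻¹ * A) ((α ^ 3)⁻¹ * B)).Δ ≠ 0 := by
  have : (shortWeierstrass (ZMod p) ((α ^ 2)⁻¹ * A) ((α ^ 3)⁻¹ * B)).Δ =
     (α ^ 6)⁻¹ * (shortWeierstrass (ZMod p) A B).Δ := by
    rw [sw_Δ, sw_Δ]; field_simp
  rw [this]
  exact mul_ne_zero (inv_ne_zero (pow_ne_zero _ hα)) hΔ

lemma twist_card (hp : p = 2 * (p / 2) + 1) {α : ZMod p} (hα : ¬ IsSquare α) (hΔ : (shortWeierstrass (ZMod p) A B).Δ ≠ 0) :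
    (Nat.card (shortWeierstrass (ZMod p) ((α ^ 2)⁻¹ * A) ((α ^ 3)⁻¹ * B)).Point : ℤ) +
      Nat.card (shortWeierstrass (ZMod p) A B).Point = 2 * p + 2 := by
  classical
  have h0 := alpha_ne hα
  rw [(card_point hΔ).2, (card_point (twist_Δ h0 hΔ)).2]
  push_cast
  have hc : ringChar (ZMod p) ≠ 2 := by rw [ZMod.ringChar_zmod_n]; omega
  have h1 : quadraticChar (ZMod p) ((α ^ 3)⁻¹) = -1 := by
    rw [show (α ^ 3)⁻¹ = (α⁻¹ ^ 2) ^ 2 * α by field_simp, map_mul,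
      quadraticChar_sq_one' (pow_ne_zero 2 (inv_ne_zero h0)), one_mul]
    exact quadraticChar_neg_one_iff_not_isSquare.2 hα
  have h2 : ∀ a, (mm ((α ^ 2)⁻¹ * A) ((α ^ 3)⁻¹ * B) a : ℤ) = 2 - mm A B (α * a) := by
    intro a
    rw [mm_eq hp, mm_eq hp]
    have : (lam ((α ^ 2)⁻¹ * A) ((α ^ 3)⁻¹ * B)).eval a = (α ^ 3)⁻¹ * (lam A B).eval (α * a) := by
      simp [lam]; field_simp
    rw [this, map_mul, h1]; ring
  have h3 : ∑ a, (mm A B (α * a) : ℤ) = ∑ a, (mm A B a : ℤ) :=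
    Equiv.sum_comp (Equiv.mulLeft₀ α h0) fun a => (mm A B a : ℤ)
  rw [Finset.sum_congr rfl fun a _ => h2 a, Finset.sum_sub_distrib, h3]
  simp [ZMod.card]; ring

lemma main_count {L : Type} [Field L] [Algebra (ZMod p) L] {α : ZMod p} (hα : ¬ IsSquare α) (hΔ : (shortWeierstrass (ZMod p) A B).Δ ≠ 0)
    {β : L} (hβ : β ^ 2 = algebraMap (ZMod p) L α) {n : ℕ} (hn : n ≠ 0) (h1 : ∀ P : (shortWeierstrass (ZMod p) A B).Point, n • P = 0)
    (h2 : ∀ P : (shortWeierstrass (ZMod p) ((α ^ 2)⁻¹ * A) ((α ^ 3)⁻¹ * B)).Point, n • P = 0) :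
    Nat.card (shortWeierstrass (ZMod p) A B).Point *
      Nat.card (shortWeierstrass (ZMod p) ((α ^ 2)⁻¹ * A) ((α ^ 3)⁻¹ * B)).Point ≤ 8 * (2 * n ^ 2) := by
  classical
  have h0 := alpha_ne hα
  have hΔt := twist_Δ h0 hΔ
  have := (card_point hΔ).1
  have := (card_point hΔt).1
  set φ := algebraMap (ZMod p) L with hφdef
  have hφ : Function.Injective φ := φ.injective
  have hα' : φ α ≠ 0 := (map_ne_zero_iff _ hφ).2 h0
  have hβ0 : β ≠ 0 := by rintro rfl; rw [zero_pow two_ne_zero] at hβ; exact hα' hβ.symm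
  have hΔL : (shortWeierstrass L (φ A) (φ B)).Δ ≠ 0 := L_Δ hΔ
  let f := scHom φ 1 one_ne_zero hΔ hΔL (by simp) (by simp)
  let g := scHom φ β hβ0 hΔt hΔL
    (by rw [show β ^ 4 = (β ^ 2) ^ 2 by ring, hβ]; simp only [map_mul, map_inv₀, map_pow]; field_simp)
    (by rw [show β ^ 6 = (β ^ 2) ^ 3 by ring, hβ]; simp only [map_mul, map_inv₀, map_pow]; field_simp)
  have hf : Function.Injective f := scHom_inj _ _ _ _ _
  have hg : Function.Injective g := scHom_inj _ _ _ _ _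
  let _ := Fintype.ofFinite (shortWeierstrass (ZMod p) A B).Point
  let _ := Fintype.ofFinite (shortWeierstrass (ZMod p) ((α ^ 2)⁻¹ * A) ((α ^ 3)⁻¹ * B)).Point
  have hker : ∀ P Q, f P = g Q → 2 • f P = 0 := by
    rintro (_ | ⟨x, y, h⟩) (_ | ⟨x', y', h'⟩) e
    · exact smul_zero _
    · exact smul_zero _
    · obtain ⟨h', e'⟩ := scHom_some (φ := φ) one_ne_zero hΔ hΔL (by simp) (by simp) x y h
      have : f (.some x y h) = 0 := e.trans (map_zero g)
      exact absurd (e'.symm.trans this) (Point.some_ne_zero _)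
    · obtain ⟨w1, w2⟩ : ∃ w, f (.some x y h) = .some (1 ^ 2 * φ x) (1 ^ 3 * φ y) w := ⟨_, rfl⟩
      obtain ⟨w3, w4⟩ : ∃ w, g (.some x' y' h') = .some (β ^ 2 * φ x') (β ^ 3 * φ y') w := ⟨_, rfl⟩
      have e2 : (1 : L) ^ 3 * φ y = β ^ 3 * φ y' := by
        rw [w2, w4, Point.some.injEq] at e
        exact e.2
      have hy : y = 0 := by
        by_contra hy
        have hy' : y' ≠ 0 := by
          rintro rfl
          simp at e2
          exact hy e2
        have hy'' : φ y' ≠ 0 := (map_ne_zero_iff _ hφ).2 hy'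
        apply hα
        refine ⟨y / (α * y'), hφ ?_⟩
        rw [map_mul, map_div₀, map_mul, ← hβ]
        rw [one_pow, one_mul] at e2
        rw [e2]
        field_simp
      subst hy
      rw [two_nsmul]
      rw [w2, Point.add_of_Y_eq rfl]
      rw [sw_negY]; simp
  let h := fun x : (shortWeierstrass (ZMod p) A B).Point ×
    (shortWeierstrass (ZMod p) ((α ^ 2)⁻¹ * A) ((α ^ 3)⁻¹ * B)).Point => f x.1 + g x.2
  rw [Nat.card_eq_fintype_card, Nat.card_eq_fintype_card, ← Fintype.card_prod, ← Finset.card_univ]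
  refine (Finset.card_le_mul_card_image (f := h) Finset.univ 8 ?_).trans ?_
  · intro c hc
    obtain ⟨z, -, hz⟩ := Finset.mem_image.1 hc
    have hinj : Set.InjOn (fun x : (shortWeierstrass (ZMod p) A B).Point ×
        (shortWeierstrass (ZMod p) ((α ^ 2)⁻¹ * A) ((α ^ 3)⁻¹ * B)).Point => f (x.1 - z.1))
        (Finset.univ.filter fun x => h x = c : Finset _) := by
      intro x hx y hy hxy
      simp only [Finset.coe_filter, Finset.mem_univ, true_and, Set.mem_ofPred_eq] at hx hy
      have e1 : x.1 = y.1 := by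
        have := hf hxy
        simpa using this
      have e2 : h x = h y := hx.trans hy.symm
      simp only [h] at e2
      rw [e1] at e2
      exact Prod.ext e1 (hg (add_left_cancel e2))
    rw [← Finset.card_image_of_injOn hinj]
    refine (torsion_card hΔ two_ne_zero _ ?_).trans (by norm_num)
    intro P hP
    obtain ⟨x, hx, rfl⟩ := Finset.mem_image.1 hP
    have hx' : h x = h z := (Finset.mem_filter.1 hx).2.trans hz.symm
    refine hker _ (z.2 - x.2) ?_
    rw [map_sub, map_sub]
    simp only [h] at hx'
    rw [sub_eq_sub_iff_add_eq_add, hx', add_comm]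
  · refine Nat.mul_le_mul_left _ (torsion_card hΔ hn _ ?_)
    intro P hP
    obtain ⟨x, -, rfl⟩ := Finset.mem_image.1 hP
    simp only [h]
    rw [nsmul_add, ← map_nsmul, ← map_nsmul, h1, h2, map_zero, map_zero, add_zero]
end fin

/-- For `p > 2²⁰`, `0 < |σ - p - 1| ≤ 2√p`, `#E(𝔽_p) ≠ σ`, and with every point of the
quadratic twist `Eᵗ(𝔽_p)` annihilated by `2p + 2 - σ`, the set
`S = {P ∈ E(𝔽_p) : σ • P = 0}` is a proper subgroup of `E(𝔽_p)` and
`#S ≤ #E(𝔽_p)/2 ≤ (p + 1 + 2√p)/2`. -/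
theorem stmt_16 (p : ℕ) [Fact p.Prime] (hp : 2 ^ 20 < p) (σ : ℕ) (hσ0 : 0 < σ)
    (hσ1 : 0 < |(σ : ℝ) - p - 1|) (hσ2 : |(σ : ℝ) - p - 1| ≤ 2 * Real.sqrt p)
    (A B α : ZMod p) (hα : ¬ IsSquare α)
    (hΔ : (shortWeierstrass (ZMod p) A B).Δ ≠ 0)
    (hcard : Nat.card (shortWeierstrass (ZMod p) A B).Point ≠ σ)
    (hEt : ∀ Q : (shortWeierstrass (ZMod p) ((α ^ 2)⁻¹ * A) ((α ^ 3)⁻¹ * B)).Point,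
      (2 * (p : ℤ) + 2 - (σ : ℤ)) • Q = 0) :
    ∃ S : AddSubgroup (shortWeierstrass (ZMod p) A B).Point,
      (∀ P : (shortWeierstrass (ZMod p) A B).Point, P ∈ S ↔ σ • P = 0) ∧
      S ≠ ⊤ ∧
      (Nat.card S : ℝ) ≤ (Nat.card (shortWeierstrass (ZMod p) A B).Point : ℝ) / 2 ∧
      (Nat.card (shortWeierstrass (ZMod p) A B).Point : ℝ) / 2 ≤
        ((p : ℝ) + 1 + 2 * Real.sqrt p) / 2 := by
  classical
  have hpo : p = 2 * (p / 2) + 1 := by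
    rcases (Fact.out : p.Prime).eq_two_or_odd with h | h
    · omega
    · omega
  have hH := hasse hpo hΔ
  have hT := twist_card hpo hα hΔ
  have hfin := (card_point hΔ).1
  have hkill : ∀ P : (shortWeierstrass (ZMod p) A B).Point,
      Nat.card (shortWeierstrass (ZMod p) A B).Point • P = 0 := fun P => card_nsmul_eq_zero'
  have hkill' : ∀ P : (shortWeierstrass (ZMod p) ((α ^ 2)⁻¹ * A) ((α ^ 3)⁻¹ * B)).Point,
      Nat.card (shortWeierstrass (ZMod p) ((α ^ 2)⁻¹ * A) ((α ^ 3)⁻¹ * B)).Point • P = 0 :=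
    fun P => card_nsmul_eq_zero'
  have hcount := fun n hn => main_count (n := n) hα hΔ
    (IsAlgClosed.exists_pow_nat_eq (algebraMap (ZMod p) (AlgebraicClosure (ZMod p)) α) two_pos).choose_spec hn
  generalize Nat.card (shortWeierstrass (ZMod p) ((α ^ 2)⁻¹ * A) ((α ^ 3)⁻¹ * B)).Point = N' at hT hkill' hcount
  set N := Nat.card (shortWeierstrass (ZMod p) A B).Point with hN
  have hp0 : (0 : ℝ) ≤ p := Nat.cast_nonneg p
  have hsq := Real.sq_sqrt hp0
  have hsn := Real.sqrt_nonneg (p : ℝ)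
  have hσ3 : ((σ : ℤ) - p - 1) ^ 2 ≤ 4 * p := by
    have : ((σ : ℝ) - p - 1) ^ 2 ≤ 4 * p := by
      rw [← sq_abs]
      have := abs_nonneg ((σ : ℝ) - p - 1)
      nlinarith
    exact_mod_cast this
  have hmem : ∀ P : (shortWeierstrass (ZMod p) A B).Point,
      P ∈ (nsmulAddMonoidHom (α := (shortWeierstrass (ZMod p) A B).Point) σ).ker ↔ σ • P = 0 := fun P => Iff.rfl
  have htop : (nsmulAddMonoidHom (α := (shortWeierstrass (ZMod p) A B).Point) σ).ker ≠ ⊤ := by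
    intro htop
    have hσk : ∀ P : (shortWeierstrass (ZMod p) A B).Point, σ • P = 0 := fun P => by
      rw [← hmem, htop]; trivial
    set r : ℤ := N - σ with hr
    have hr0 : r ≠ 0 := by
      intro h; apply hcard; omega
    have hrn : r.natAbs ≠ 0 := Int.natAbs_ne_zero.2 hr0
    have hc := hcount r.natAbs hrn (fun P => by
      have : r • P = 0 := by rw [hr, sub_zsmul, natCast_zsmul, natCast_zsmul, hkill, hσk, neg_zero, add_zero]
      rcases Int.natAbs_eq r with h | h
      · rw [← natCast_zsmul, ← h, this]
      · rw [← natCast_zsmul, ← neg_eq_zero, ← neg_zsmul, ← h, this]) (fun P => by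
      have : r • P = 0 := by
        rw [show r = (2 * (p : ℤ) + 2 - (σ : ℤ)) - (N' : ℤ) by linarith, sub_zsmul, hEt, natCast_zsmul, hkill',
          neg_zero, add_zero]
      rcases Int.natAbs_eq r with h | h
      · rw [← natCast_zsmul, ← h, this]
      · rw [← natCast_zsmul, ← neg_eq_zero, ← neg_zsmul, ← h, this])
    have hc' : (N : ℤ) * N' ≤ 8 * (2 * r ^ 2) := by
      rw [← Int.natAbs_sq r]; exact_mod_cast hc
    have hN' : (N' : ℤ) = 2 * p + 2 - N := by linarith
    rw [hN'] at hc'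
    have hr2 : r ^ 2 ≤ 16 * p := by
      have e : r = ((N : ℤ) - p - 1) - ((σ : ℤ) - p - 1) := by rw [hr]; ring
      rw [e]
      nlinarith [sq_nonneg (((N : ℤ) - p - 1) + ((σ : ℤ) - p - 1))]
    have hp' : (2 : ℤ) ^ 20 < p := by exact_mod_cast hp
    have : ((p : ℤ) - 1) ^ 2 ≤ 256 * p := by nlinarith
    nlinarith
  refine ⟨_, hmem, htop, ?_, ?_⟩
  · generalize (nsmulAddMonoidHom (α := (shortWeierstrass (ZMod p) A B).Point) σ).ker = S at htop
    have h1 := S.card_mul_index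
    have h2 : S.index ≠ 1 := fun h => htop (AddSubgroup.index_eq_one.1 h)
    have h3 : S.index ≠ 0 := AddSubgroup.index_ne_zero_of_finite
    have h4 : Nat.card S * 2 ≤ N := by
      rw [hN, ← h1]; exact Nat.mul_le_mul_left _ (by omega)
    have h5 : (Nat.card S : ℝ) * 2 ≤ N := by exact_mod_cast h4
    linarith
  · have hH' : ((N : ℝ) - p - 1) ^ 2 ≤ 4 * p := by exact_mod_cast hH
    have : (N : ℝ) - p - 1 ≤ 2 * Real.sqrt p := by
      exact abs_le_of_sq_le_sq' (by nlinarith) (by positivity) |>.2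
    linarith
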